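/- Let t ≥ 4 be a rational number and G a t-tough, non-Hamiltonian graph on n ≥ 3 vertices. Let z be a vertex such that G − z has a Hamilton cycle C, let x, y be distinct neighbors of z, and suppose deg(x^+) + deg(y^+) ≥ n − t. With X = N(x^+), Y_1 = {w^− : w ∈ N(y^+) ∩ V^+_{y^+ x}}, Y_2 = {w^+ : w ∈ N(y^+) ∩ V^−_{y^+ x}}, Y = Y_1 ∪ Y_2, Z = {w^+ : w ∈ N(z)}, and R = V(G) ∖ (X ∪ Y ∪ Z), we have |R ∪ (Z ∖ Y)| ≤ t + 1 and |Y ∩ Z| ≥ |R| + t − 1. -/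

import Mathlib

/-- A graph `G` is `t`-tough if `|S| ≥ t · c(G − S)` for every vertex subset `S`
whose removal leaves at least two connected components. -/
def SimpleGraph.Tough {V : Type*} [Fintype V] (t : ℚ) (G : SimpleGraph V) : Prop :=
  ∀ S : Finset V,
    2 ≤ Nat.card ((G.induce ((↑S : Set V)ᶜ)).ConnectedComponent) →
    t * (Nat.card ((G.induce ((↑S : Set V)ᶜ)).ConnectedComponent) : ℚ) ≤ (S.card : ℚ)

/-- Given an oriented Hamilton cycle of `G − z`, encoded as a bijection
`c : ZMod m ≃ {u // u ≠ z}` with consecutive vertices adjacent, `cycNext c w`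
is the successor `w⁺` of a vertex `w ≠ z` on the oriented cycle (and `z` itself
for `w = z`). -/
def cycNext {V : Type*} [DecidableEq V] {z : V} {m : ℕ}
    (c : ZMod m ≃ {u : V // u ≠ z}) (w : V) : V :=
  if h : w = z then w else (c (c.symm ⟨w, h⟩ + 1)).1

/-- The predecessor `w⁻` of a vertex `w ≠ z` on the oriented cycle. -/
def cycPrev {V : Type*} [DecidableEq V] {z : V} {m : ℕ}
    (c : ZMod m ≃ {u : V // u ≠ z}) (w : V) : V :=
  if h : w = z then w else (c (c.symm ⟨w, h⟩ - 1)).1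

/-- `cycArc c a b` is `V⁺_{ab}`: the set of vertices on the arc of the cycle
from `a` to `b` following the orientation, both endpoints included.
(Note `V⁻_{ab} = cycArc c b a`.) -/
def cycArc {V : Type*} {z : V} {m : ℕ}
    (c : ZMod m ≃ {u : V // u ≠ z}) (a b : V) : Set V :=
  {w : V | ∃ (ha : a ≠ z) (hb : b ≠ z) (hw : w ≠ z),
    (c.symm ⟨w, hw⟩ - c.symm ⟨a, ha⟩).val ≤ (c.symm ⟨b, hb⟩ - c.symm ⟨a, ha⟩).val}

theorem SimpleGraph.isHamiltonian_of_isChain {V : Type*} [Fintype V] [DecidableEq V]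
    {G : SimpleGraph V} {l : List V} (hcard : 3 ≤ Fintype.card V) (hnodup : l.Nodup)
    (hmem : ∀ v, v ∈ l) (hchain : l.IsChain G.Adj)
    (hclose : ∀ a ∈ l.getLast?, ∀ b ∈ l.head?, G.Adj a b) : G.IsHamiltonian := by
  intro _
  have hlen : l.length = Fintype.card V := by
    rw [← List.toFinset_card_of_nodup hnodup, ← Finset.card_univ]
    congr 1
    ext v
    simp [hmem]
  have hne : l ≠ [] := by
    rintro rfl
    simp at hlen
    omega
  have hadj : G.Adj (l.getLast hne) (l.head hne) :=
    hclose _ (List.getLast?_eq_some_getLast hne) _ (List.head?_eq_some_head hne)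
  have hp : (SimpleGraph.Walk.ofSupport l hne hchain).IsPath := by
    rw [SimpleGraph.Walk.isPath_def, SimpleGraph.Walk.support_ofSupport]
    exact hnodup
  refine ⟨_, .cons hadj (SimpleGraph.Walk.ofSupport l hne hchain), ?_⟩
  rw [SimpleGraph.Walk.isHamiltonianCycle_iff_isCycle_and_length_eq, SimpleGraph.Walk.isCycle_iff_isPath_tail_and_le_length,
    SimpleGraph.Walk.length_cons, SimpleGraph.Walk.length_ofSupport]
  refine ⟨⟨?_, by omega⟩, by omega⟩
  simpa using hp

/-- `f 0, …, f (m - 1)` is a Hamilton path of `G - z`. -/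
structure SimpleGraph.IsHamPathAvoiding {V : Type*} (G : SimpleGraph V) (z : V) (m : ℕ)
    (f : ℕ → V) : Prop where
  inj : ∀ i < m, ∀ j < m, f i = f j → i = j
  ne : ∀ i < m, f i ≠ z
  surj : ∀ v, v ≠ z → ∃ i < m, f i = v
  adj : ∀ i, i + 1 < m → G.Adj (f i) (f (i + 1))

namespace SimpleGraph.IsHamPathAvoiding

variable {V : Type*} {G : SimpleGraph V} {z : V} {m : ℕ} {f : ℕ → V}

theorem isChain_map_range' (h : G.IsHamPathAvoiding z m f) (i k : ℕ) (hik : i + k ≤ m) :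
    ((List.range' i k).map f).IsChain G.Adj := by
  induction k generalizing i with
  | zero => simp
  | succ k ih =>
    rw [List.range'_succ, List.map_cons, List.isChain_cons]
    refine ⟨?_, ih (i + 1) (by omega)⟩
    intro b hb
    have hk : k ≠ 0 := by rintro rfl; simp at hb
    simp [List.head?_range', hk] at hb
    exact hb ▸ h.adj i (by omega)

theorem isChain_reverse_map_range' (h : G.IsHamPathAvoiding z m f) (i k : ℕ) (hik : i + k ≤ m) :
    ((List.range' i k).map f).reverse.IsChain G.Adj := by
  rw [List.isChain_reverse]
  exact (h.isChain_map_range' i k hik).imp fun _ _ hab => hab.symm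

theorem isHamiltonian_of_perm [Fintype V] [DecidableEq V] (h : G.IsHamPathAvoiding z m f)
    (hcard : 3 ≤ Fintype.card V) {l : List V} (hl : l.Perm ((List.range' 0 m).map f))
    (hchain : l.IsChain G.Adj) (hhead : ∀ a ∈ l.head?, G.Adj z a)
    (hlast : ∀ a ∈ l.getLast?, G.Adj a z) : G.IsHamiltonian := by
  have hl' : (z :: l).Perm (z :: (List.range' 0 m).map f) := hl.cons z
  have hnodup : (z :: (List.range' 0 m).map f).Nodup := by
    rw [List.nodup_cons]
    refine ⟨?_, List.Nodup.map_on ?_ List.nodup_range'⟩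
    · simp only [List.mem_map, List.mem_range'_1, not_exists, not_and]
      exact fun i hi => h.ne i (by omega)
    · simp only [List.mem_range'_1]
      exact fun i hi j hj hij => h.inj i (by omega) j (by omega) hij
  refine isHamiltonian_of_isChain (l := z :: l) hcard (hl'.nodup_iff.2 hnodup) ?_ ?_ ?_
  · intro v
    rw [hl'.mem_iff]
    by_cases hv : v = z
    · simp [hv]
    · obtain ⟨i, hi, rfl⟩ := h.surj v hv
      exact List.mem_cons_of_mem _ (List.mem_map.2 ⟨i, by simp [hi], rfl⟩)
  · rw [List.isChain_cons]
    exact ⟨hhead, hchain⟩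
  · have hne : l ≠ [] := by
      rintro rfl
      have h1 := hl.length_eq
      simp at h1
      have : Subsingleton V := ⟨fun a b => by
        have ha : a = z := by
          by_contra ha
          obtain ⟨i, hi, -⟩ := h.surj a ha
          omega
        have hb : b = z := by
          by_contra hb
          obtain ⟨i, hi, -⟩ := h.surj b hb
          omega
        rw [ha, hb]⟩
      have := Fintype.card_le_one_iff_subsingleton.2 this
      omega
    intro a ha b hb
    rw [List.getLast?_cons_of_ne_nil hne] at ha
    simp at hb
    exact hb ▸ hlast a ha

theorem map_range'_append (f : ℕ → V) {i j k : ℕ} (hij : i ≤ j) (hjk : j ≤ k) :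
    (List.range' i (j - i)).map f ++ (List.range' j (k - j)).map f =
      (List.range' i (k - i)).map f := by
  obtain ⟨a, rfl⟩ := Nat.exists_eq_add_of_le hij
  obtain ⟨b, rfl⟩ := Nat.exists_eq_add_of_le hjk
  rw [← List.map_append, Nat.add_sub_cancel_left, Nat.add_sub_cancel_left,
    List.range'_append_1, Nat.add_assoc, Nat.add_sub_cancel_left]

variable [Fintype V] [DecidableEq V]

theorem isHamiltonian_of_adj_ends (h : G.IsHamPathAvoiding z m f) (hcard : 3 ≤ Fintype.card V)
    (h0 : G.Adj z (f 0)) (h1 : G.Adj z (f (m - 1))) : G.IsHamiltonian := by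
  refine h.isHamiltonian_of_perm hcard (List.Perm.refl _) (h.isChain_map_range' _ _ (by omega))
    ?_ ?_ <;> (simp [List.head?_range', List.getLast?_range']; try grind [G.adj_comm])

theorem isHamiltonian_of_adj_consecutive (h : G.IsHamPathAvoiding z m f)
    (hcard : 3 ≤ Fintype.card V) (hclose : G.Adj (f (m - 1)) (f 0)) {p : ℕ} (hp : p + 1 < m)
    (h0 : G.Adj z (f p)) (h1 : G.Adj z (f (p + 1))) : G.IsHamiltonian := by
  refine h.isHamiltonian_of_perm hcard
    (l := (List.range' (p + 1) (m - (p + 1))).map f ++ (List.range' 0 (p + 1 - 0)).map f)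
    ?_ ?_ ?_ ?_
  · have := map_range'_append f (Nat.zero_le (p + 1)) hp.le
    rw [Nat.sub_zero m] at this
    rw [← this]
    exact List.perm_append_comm
  · rw [List.isChain_append]
    refine ⟨h.isChain_map_range' _ _ (by omega), h.isChain_map_range' _ _ (by omega), ?_⟩
    simp [List.head?_range', List.getLast?_range']
    grind
  all_goals
    simp [List.head?_range', List.getLast?_range']
    grind [G.adj_comm]

theorem isHamiltonian_of_adj_succ (h : G.IsHamPathAvoiding z m f)
    (hcard : 3 ≤ Fintype.card V) {p : ℕ} (hp : p + 1 < m)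
    (h0 : G.Adj z (f p)) (h1 : G.Adj z (f (m - 1))) (h2 : G.Adj (f 0) (f (p + 1))) :
    G.IsHamiltonian := by
  refine h.isHamiltonian_of_perm hcard
    (l := ((List.range' (p + 1) (m - (p + 1))).map f).reverse ++
      (List.range' 0 (p + 1 - 0)).map f) ?_ ?_ ?_ ?_
  · have := map_range'_append f (Nat.zero_le (p + 1)) hp.le
    rw [Nat.sub_zero m] at this
    rw [← this, List.perm_iff_count]
    intro a
    simp only [List.count_append, List.count_reverse]
    omega
  · rw [List.isChain_append]
    refine ⟨h.isChain_reverse_map_range' _ _ (by omega), h.isChain_map_range' _ _ (by omega), ?_⟩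
    simp [List.head?_range']
    grind [G.adj_comm]
  all_goals
    simp [List.head?_range', List.getLast?_range']
    grind [G.adj_comm]

theorem isHamiltonian_of_crossing_right (h : G.IsHamPathAvoiding z m f)
    (hcard : 3 ≤ Fintype.card V) {p j : ℕ} (hpj : p + 1 ≤ j) (hj : j + 1 < m)
    (h0 : G.Adj z (f p)) (h1 : G.Adj z (f (m - 1))) (h2 : G.Adj (f 0) (f j))
    (h3 : G.Adj (f (p + 1)) (f (j + 1))) : G.IsHamiltonian := by
  refine h.isHamiltonian_of_perm hcard
    (l := ((List.range' (j + 1) (m - (j + 1))).map f).reverse ++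
      ((List.range' (p + 1) (j + 1 - (p + 1))).map f ++
      (List.range' 0 (p + 1 - 0)).map f)) ?_ ?_ ?_ ?_
  · have := map_range'_append f (Nat.zero_le (j + 1)) hj.le
    rw [Nat.sub_zero m, ← map_range'_append f (Nat.zero_le (p + 1)) (by omega : p + 1 ≤ j + 1)]
      at this
    rw [← this, List.perm_iff_count]
    intro a
    simp only [List.count_append, List.count_reverse]
    omega
  · rw [List.isChain_append, List.isChain_append]
    refine ⟨h.isChain_reverse_map_range' _ _ (by omega),
      ⟨h.isChain_map_range' _ _ (by omega), h.isChain_map_range' _ _ (by omega), ?_⟩, ?_⟩ <;>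
    simp [List.head?_range', List.getLast?_range', List.head?_append] <;>
    grind [G.adj_comm]
  all_goals
    simp [List.head?_range', List.getLast?_range', List.head?_append]
    grind [G.adj_comm]

theorem isHamiltonian_of_crossing_left (h : G.IsHamPathAvoiding z m f)
    (hcard : 3 ≤ Fintype.card V) {p j : ℕ} (hjp : j + 1 ≤ p) (hp : p + 1 < m)
    (h0 : G.Adj z (f p)) (h1 : G.Adj z (f (m - 1))) (h2 : G.Adj (f 0) (f (j + 1)))
    (h3 : G.Adj (f (p + 1)) (f j)) : G.IsHamiltonian := by
  refine h.isHamiltonian_of_perm hcard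
    (l := ((List.range' (p + 1) (m - (p + 1))).map f).reverse ++
      (((List.range' 0 (j + 1 - 0)).map f).reverse ++
      (List.range' (j + 1) (p + 1 - (j + 1))).map f)) ?_ ?_ ?_ ?_
  · have := map_range'_append f (Nat.zero_le (p + 1)) hp.le
    rw [Nat.sub_zero m, ← map_range'_append f (Nat.zero_le (j + 1)) (by omega : j + 1 ≤ p + 1)]
      at this
    rw [← this, List.perm_iff_count]
    intro a
    simp only [List.count_append, List.count_reverse]
    omega
  · rw [List.isChain_append, List.isChain_append]
    refine ⟨h.isChain_reverse_map_range' _ _ (by omega),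
      ⟨h.isChain_reverse_map_range' _ _ (by omega), h.isChain_map_range' _ _ (by omega), ?_⟩, ?_⟩ <;>
    simp [List.head?_range', List.getLast?_range', List.head?_append] <;>
    grind [G.adj_comm]
  all_goals
    simp [List.head?_range', List.getLast?_range', List.head?_append]
    grind [G.adj_comm]

end SimpleGraph.IsHamPathAvoiding

theorem SimpleGraph.ncard_neighborSet {V : Type*} [Fintype V] (G : SimpleGraph V)
    [DecidableRel G.Adj] (v : V) : (G.neighborSet v).ncard = G.degree v := by
  rw [← Nat.card_coe_set_eq, Nat.card_eq_fintype_card, SimpleGraph.card_neighborSet_eq_degree]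

theorem SimpleGraph.Tough.two_mul_le_degree {V : Type*} [Fintype V] {G : SimpleGraph V}
    [DecidableRel G.Adj] {t : ℚ} (ht : 0 ≤ t) (hG : SimpleGraph.Tough t G) {z w : V}
    (hzw : z ≠ w) (hnadj : ¬ G.Adj z w) : 2 * t ≤ G.degree z := by
  have hz : z ∈ ((G.neighborFinset z : Finset V) : Set V)ᶜ := by simp
  have hw : w ∈ ((G.neighborFinset z : Finset V) : Set V)ᶜ := by simpa using hnadj
  have h2 : 2 ≤ Nat.card
      (G.induce ((G.neighborFinset z : Finset V) : Set V)ᶜ).ConnectedComponent := by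
    have : Nontrivial
        (G.induce ((G.neighborFinset z : Finset V) : Set V)ᶜ).ConnectedComponent := by
      refine ⟨(G.induce _).connectedComponentMk ⟨z, hz⟩,
        (G.induce _).connectedComponentMk ⟨w, hw⟩, fun heq => ?_⟩
      obtain ⟨q⟩ := SimpleGraph.ConnectedComponent.exact heq
      cases q with
      | nil => exact hzw rfl
      | cons hadj _ =>
        rename_i v _
        exact v.2 (by simpa using hadj)
    exact Finite.one_lt_card
  have h := hG _ h2
  rw [card_neighborFinset_eq_degree] at h
  have h2' : (2 : ℚ) ≤ Nat.card
      (G.induce ((G.neighborFinset z : Finset V) : Set V)ᶜ).ConnectedComponent := by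
    exact_mod_cast h2
  nlinarith

/-- The vertices of the oriented cycle listed from position `s` on. -/
def cycSeq {V : Type*} {z : V} {m : ℕ} (c : ZMod m ≃ {u : V // u ≠ z}) (s : ZMod m) (k : ℕ) : V :=
  (c (s + k)).1

section cycSeq

variable {V : Type*} {z : V} {m : ℕ} (c : ZMod m ≃ {u : V // u ≠ z}) (s : ZMod m)

theorem cycSeq_ne (k : ℕ) : cycSeq c s k ≠ z := (c (s + k)).2

theorem cycSeq_add_period (k : ℕ) : cycSeq c s (k + m) = cycSeq c s k := by
  simp [cycSeq]

theorem symm_cycSeq (k : ℕ) (h : cycSeq c s k ≠ z) : c.symm ⟨cycSeq c s k, h⟩ = s + k := by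
  simp [cycSeq]

theorem cycNext_cycSeq [DecidableEq V] (k : ℕ) :
    cycNext c (cycSeq c s k) = cycSeq c s (k + 1) := by
  rw [cycNext, dif_neg (cycSeq_ne c s k), symm_cycSeq]
  simp [cycSeq, add_assoc]

theorem cycPrev_cycSeq_succ [DecidableEq V] (k : ℕ) :
    cycPrev c (cycSeq c s (k + 1)) = cycSeq c s k := by
  rw [cycPrev, dif_neg (cycSeq_ne c s _), symm_cycSeq]
  simp [cycSeq, ← add_assoc]

theorem cycSeq_mem_cycArc_iff (i : ℕ) {d e : ℕ} (hd : d < m) (he : e < m) :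
    cycSeq c s (i + d) ∈ cycArc c (cycSeq c s i) (cycSeq c s (i + e)) ↔ d ≤ e := by
  have key : ∀ d < m, ((s + (i + d : ℕ)) - (s + i) : ZMod m).val = d := by
    intro d hd
    have : ((s + (i + d : ℕ)) - (s + i) : ZMod m) = (d : ℕ) := by push_cast; ring
    rw [this, ZMod.val_natCast_of_lt hd]
  constructor
  · rintro ⟨_, _, _, h⟩
    simpa only [symm_cycSeq, key d hd, key e he] using h
  · intro h
    refine ⟨cycSeq_ne c s _, cycSeq_ne c s _, cycSeq_ne c s _, ?_⟩
    simpa only [symm_cycSeq, key d hd, key e he] using h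

theorem exists_cycSeq_eq [NeZero m] {v : V} (hv : v ≠ z) : ∃ i < m, cycSeq c s i = v :=
  ⟨(c.symm ⟨v, hv⟩ - s).val, ZMod.val_lt _, by simp [cycSeq]⟩

theorem isHamPathAvoiding_cycSeq [NeZero m] {G : SimpleGraph V}
    (hC : ∀ i : ZMod m, G.Adj (c i).1 (c (i + 1)).1) :
    G.IsHamPathAvoiding z m (cycSeq c s) where
  inj i hi j hj hij := by
    have h : (i : ZMod m) = j := add_left_cancel (c.injective (Subtype.ext hij))
    rw [← ZMod.val_natCast_of_lt hi, h, ZMod.val_natCast_of_lt hj]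
  ne i _ := cycSeq_ne c s i
  surj _ hv := exists_cycSeq_eq c s hv
  adj i _ := by
    have := hC (s + i)
    rw [add_assoc] at this
    simpa [cycSeq] using this

end cycSeq

/-- Let `t ≥ 4` be rational and `G` a `t`-tough non-Hamiltonian graph on
`n ≥ 3` vertices, `z` a vertex with `G − z` having an oriented Hamilton cycle
(encoded by `c`), and `x, y` distinct neighbors of `z` with
`deg(x⁺) + deg(y⁺) ≥ n − t`.  With `X = N(x⁺)`,
`Y = (N(y⁺) ∩ V⁺_{y⁺x})⁻ ∪ (N(y⁺) ∩ V⁻_{y⁺x})⁺`, `Z = N(z)⁺` and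
`R = V(G) ∖ (X ∪ Y ∪ Z)`, we have `|R ∪ (Z ∖ Y)| ≤ t + 1` and
`|Y ∩ Z| ≥ |R| + t − 1`. -/
theorem R_and_Z_cardinality_bounds
    {V : Type*} [Fintype V] [DecidableEq V] (G : SimpleGraph V) [DecidableRel G.Adj]
    (n : ℕ) (t : ℚ) (ht : 4 ≤ t) (hn : Fintype.card V = n) (hn3 : 3 ≤ n)
    (htough : SimpleGraph.Tough t G) (hnotham : ¬ G.IsHamiltonian)
    (z : V) (m : ℕ) (hm : 3 ≤ m) (c : ZMod m ≃ {u : V // u ≠ z})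
    (hC : ∀ i : ZMod m, G.Adj (c i).1 (c (i + 1)).1)
    (x y : V) (hx : G.Adj z x) (hy : G.Adj z y) (hne : x ≠ y)
    (hdeg : (n : ℚ) - t ≤ (G.degree (cycNext c x) : ℚ) + (G.degree (cycNext c y) : ℚ))
    (X Y Z R : Set V)
    (hX : X = G.neighborSet (cycNext c x))
    (hY : Y = (cycPrev c '' (G.neighborSet (cycNext c y) ∩ cycArc c (cycNext c y) x)) ∪
              (cycNext c '' (G.neighborSet (cycNext c y) ∩ cycArc c x (cycNext c y))))
    (hZ : Z = cycNext c '' G.neighborSet z)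
    (hR : R = Set.univ \ (X ∪ Y ∪ Z)) :
    ((R ∪ (Z \ Y)).ncard : ℚ) ≤ t + 1 ∧
    (R.ncard : ℚ) + t - 1 ≤ ((Y ∩ Z).ncard : ℚ) := by
  have : NeZero m := ⟨by omega⟩
  have hcard : 3 ≤ Fintype.card V := by omega
  obtain ⟨s, hs⟩ : ∃ s, s = c.symm ⟨x, hx.ne'⟩ + 1 := ⟨_, rfl⟩
  obtain ⟨f, hf⟩ : ∃ f, f = cycSeq c s := ⟨_, rfl⟩
  have hP : G.IsHamPathAvoiding z m f := hf ▸ isHamPathAvoiding_cycSeq c s hC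
  have hper : ∀ k, f (k + m) = f k := hf ▸ cycSeq_add_period c s
  have hperiod0 : f m = f 0 := by simpa using hper 0
  have hnext : ∀ k, cycNext c (f k) = f (k + 1) := hf ▸ cycNext_cycSeq c s
  have hprev : ∀ k, cycPrev c (f (k + 1)) = f k := hf ▸ cycPrev_cycSeq_succ c s
  have harc : ∀ i {d e : ℕ}, d < m → e < m → (f (i + d) ∈ cycArc c (f i) (f (i + e)) ↔ d ≤ e) :=
    hf ▸ cycSeq_mem_cycArc_iff c s
  have hxf : x = f (m - 1) := by
    rw [hf, cycSeq, hs, Nat.cast_sub (by omega)]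
    simp
  have hm1 : m - 1 + 1 = m := by omega
  have hx0 : cycNext c x = f 0 := by rw [hxf, hnext, hm1, hperiod0]
  have hclose : G.Adj (f (m - 1)) (f 0) := by
    have := hC (s + ((m - 1 : ℕ) : ZMod m))
    rw [← hperiod0, ← hm1, hf]
    simpa [cycSeq, add_assoc] using this
  obtain ⟨p, hp, hpy⟩ := hP.surj y hy.ne'
  have hpne : p ≠ m - 1 := by
    rintro rfl
    exact hne (hxf.trans hpy)
  rw [hxf] at hx
  rw [← hpy] at hy
  have hnz : ∀ k < m, G.Adj z (f k) → ¬ G.Adj z (f (k + 1)) := by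
    intro k hk h1 h2
    by_cases hkm : k + 1 = m
    · rw [hkm, hperiod0] at h2
      exact hnotham (hP.isHamiltonian_of_adj_ends hcard h2 hx)
    · exact hnotham (hP.isHamiltonian_of_adj_consecutive hcard hclose (by omega) h1 h2)
  have hp2 : p + 2 < m := by
    by_contra hlt
    have : p + 1 = m - 1 := by omega
    exact hnz p hp hy (this ▸ hx)
  have hyp : cycNext c y = f (p + 1) := by rw [← hpy, hnext]
  rw [hx0] at hX hdeg
  rw [hyp] at hY hdeg
  rw [hxf] at hY
  have harc₁ : ∀ k < m, f k ∈ cycArc c (f (p + 1)) (f (m - 1)) ↔ p + 1 ≤ k := by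
    intro k hk
    have he : m - 1 = p + 1 + (m - 1 - (p + 1)) := by omega
    by_cases hpk : p + 1 ≤ k
    · obtain ⟨d, rfl⟩ := Nat.exists_eq_add_of_le hpk
      rw [he, harc (p + 1) (by omega) (by omega)]
      omega
    · have hk' : k + m = p + 1 + (k + m - (p + 1)) := by omega
      rw [he, ← hper k, hk', harc (p + 1) (by omega) (by omega)]
      omega
  have harc₂ : ∀ k, k + 1 < m → (f k ∈ cycArc c (f (m - 1)) (f (p + 1)) ↔ k ≤ p + 1) := by
    intro k hk
    have hk' : k + m = m - 1 + (k + 1) := by omega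
    have he : p + 1 + m = m - 1 + (p + 2) := by omega
    rw [← hper k, ← hper (p + 1), hk', he, harc (m - 1) hk hp2]
    omega
  have hXZ : Disjoint X Z := by
    rw [hX, hZ, Set.disjoint_right]
    rintro _ ⟨u, hu, rfl⟩ hadj
    obtain ⟨k, hk, rfl⟩ := hP.surj u (G.ne_of_adj hu).symm
    rw [hnext, SimpleGraph.mem_neighborSet] at hadj
    by_cases hkm : k + 1 = m
    · rw [hkm, hperiod0] at hadj
      exact G.loopless.irrefl _ hadj
    · exact hnotham (hP.isHamiltonian_of_adj_succ hcard (by omega) hu hx hadj)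
  have hXY : Disjoint X Y := by
    rw [hX, hY, Set.disjoint_right]
    rintro _ (⟨u, ⟨hu, hua⟩, rfl⟩ | ⟨u, ⟨hu, hua⟩, rfl⟩) hadj
    all_goals
      obtain ⟨k, hk, rfl⟩ := hP.surj u hua.choose_spec.choose_spec.choose
      rw [SimpleGraph.mem_neighborSet] at hu hadj
      have hkp : k ≠ p + 1 := by
        rintro rfl
        exact G.loopless.irrefl _ hu
    · rw [harc₁ k hk] at hua
      obtain ⟨j, rfl⟩ : ∃ j, k = j + 1 := ⟨k - 1, by omega⟩
      rw [hprev] at hadj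
      exact hnotham (hP.isHamiltonian_of_crossing_right hcard (by omega) hk hy hx hadj hu)
    · rw [hnext] at hadj
      by_cases hkm : k + 1 = m
      · rw [hkm, hperiod0] at hadj
        exact G.loopless.irrefl _ hadj
      rw [harc₂ k (by omega)] at hua
      by_cases hk' : k = p
      · subst hk'
        exact hnotham (hP.isHamiltonian_of_adj_succ hcard (by omega) hy hx hadj)
      · exact hnotham (hP.isHamiltonian_of_crossing_left hcard (by omega) (by omega) hy hx hadj hu)
  have hXcard : X.ncard = G.degree (f 0) := by
    rw [hX, SimpleGraph.ncard_neighborSet]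
  have hZcard : Z.ncard = G.degree z := by
    rw [hZ, Set.InjOn.ncard_image, SimpleGraph.ncard_neighborSet]
    intro u hu v hv huv
    have hu' : u ≠ z := (G.ne_of_adj hu).symm
    have hv' : v ≠ z := (G.ne_of_adj hv).symm
    simp only [cycNext, hu', hv', dite_false] at huv
    exact congrArg Subtype.val
      (c.symm.injective (add_right_cancel (c.injective (Subtype.ext huv))))
  have hnadj : ¬ G.Adj z (f (p + 1)) := hnz p hp hy
  have hYcard : G.degree (f (p + 1)) ≤ Y.ncard + 1 := by
    let T := (Finset.range m).filter fun k => G.Adj (f (p + 1)) (f k)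
    let g : ℕ → ℕ := fun k => if k ≤ p then k + 1 else k - 1
    have hT : ∀ k ∈ T, k < m ∧ k ≠ p + 1 ∧ G.Adj (f (p + 1)) (f k) := by
      intro k hk
      obtain ⟨h1, h2⟩ := Finset.mem_filter.1 hk
      refine ⟨Finset.mem_range.1 h1, ?_, h2⟩
      rintro rfl
      exact G.loopless.irrefl _ h2
    have hdegT : G.degree (f (p + 1)) ≤ T.card := by
      rw [← SimpleGraph.card_neighborFinset_eq_degree]
      refine (Finset.card_le_card ?_).trans (Finset.card_image_le (f := f))
      intro v hv
      rw [SimpleGraph.mem_neighborFinset] at hv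
      obtain ⟨k, hk, rfl⟩ := hP.surj v (by rintro rfl; exact hnadj hv.symm)
      exact Finset.mem_image_of_mem f (by simp [T, hk, hv])
    have hsub : (((T.erase p).image (f ∘ g) : Finset V) : Set V) ⊆ Y := by
      intro v hv
      obtain ⟨k, hk, rfl⟩ := Finset.mem_image.1 (Finset.mem_coe.1 hv)
      obtain ⟨hkm, hkp, hadj⟩ := hT k (Finset.mem_of_mem_erase hk)
      rw [hY]
      by_cases hle : k ≤ p
      · right
        refine ⟨f k, ⟨hadj, (harc₂ k (by omega)).2 (by omega)⟩, ?_⟩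
        simp [g, hle, hnext]
      · left
        obtain ⟨j, rfl⟩ : ∃ j, k = j + 1 := ⟨k - 1, by omega⟩
        refine ⟨f (j + 1), ⟨hadj, (harc₁ _ hkm).2 (by omega)⟩, ?_⟩
        simp only [Function.comp_apply, g, if_neg hle, hprev, Nat.add_sub_cancel]
    have hcardg : ((T.erase p).image (f ∘ g)).card = (T.erase p).card := by
      refine Finset.card_image_of_injOn ?_
      intro a ha b hb hab
      obtain ⟨hap, ha⟩ := Finset.mem_erase.1 (Finset.mem_coe.1 ha)
      obtain ⟨hbp, hb⟩ := Finset.mem_erase.1 (Finset.mem_coe.1 hb)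
      obtain ⟨ha1, ha2, -⟩ := hT a ha
      obtain ⟨hb1, hb2, -⟩ := hT b hb
      have := hP.inj (g a) (by simp only [g]; split_ifs <;> omega) (g b)
        (by simp only [g]; split_ifs <;> omega) hab
      simp only [g] at this
      split_ifs at this <;> omega
    have h1 := Set.ncard_le_ncard hsub (Set.toFinite Y)
    rw [Set.ncard_coe_finset, hcardg] at h1
    have h2 := Finset.pred_card_le_card_erase (s := T) (a := p)
    omega
  have hdegz : 2 * t ≤ G.degree z :=
    htough.two_mul_le_degree (by linarith) (hP.ne _ (by omega)).symm hnadj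
  have htotal : X.ncard + (Y.ncard + (Z \ Y).ncard) + R.ncard = n := by
    rw [← Set.ncard_union_eq Set.disjoint_sdiff_right, Set.union_sdiff_self,
      ← Set.ncard_union_eq (Set.disjoint_union_right.2 ⟨hXY, hXZ⟩), ← Set.union_assoc, hR,
      ← Set.compl_eq_univ_sdiff, Set.ncard_add_ncard_compl, Nat.card_eq_fintype_card, hn]
  have hsplit : (Y ∩ Z).ncard + (Z \ Y).ncard = Z.ncard := by
    rw [Set.inter_comm, Set.ncard_inter_add_ncard_sdiff_eq_ncard]
  have hunion : (R ∪ (Z \ Y)).ncard ≤ R.ncard + (Z \ Y).ncard := Set.ncard_union_le _ _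
  have e1 : (X.ncard : ℚ) + (Y.ncard + (Z \ Y).ncard) + R.ncard = n := by exact_mod_cast htotal
  have e2 : ((Y ∩ Z).ncard : ℚ) + (Z \ Y).ncard = Z.ncard := by exact_mod_cast hsplit
  have e3 : ((R ∪ (Z \ Y)).ncard : ℚ) ≤ R.ncard + (Z \ Y).ncard := by exact_mod_cast hunion
  have e4 : (G.degree (f (p + 1)) : ℚ) ≤ Y.ncard + 1 := by exact_mod_cast hYcard
  have e5 : (X.ncard : ℚ) = G.degree (f 0) := by exact_mod_cast hXcard
  have e6 : (Z.ncard : ℚ) = G.degree z := by exact_mod_cast hZcard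
  constructor <;> linarith
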